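/- For any linear ordinal margin matrix M with at most 5 alternatives, the SSV winner of M is a Split Cycle winner of M. -/

import Mathlib

variable {X : Type} [DecidableEq X]

/-- `(V, succ)` is an ordinal margin matrix: `V` is a nonempty (finite) set of alternatives
and `succ` (the relation `≻`) is asymmetric, negatively transitive, and ordinally
skew-symmetric on `V × V`. -/
def IsOMM (V : Finset X) (succ : X × X → X × X → Prop) : Prop :=
  V.Nonempty ∧
  (∀ p q : X × X, p.1 ∈ V → p.2 ∈ V → q.1 ∈ V → q.2 ∈ V → succ p q → ¬ succ q p) ∧
  (∀ p q r : X × X, p.1 ∈ V → p.2 ∈ V → q.1 ∈ V → q.2 ∈ V → r.1 ∈ V → r.2 ∈ V →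
      ¬ succ p q → ¬ succ q r → ¬ succ p r) ∧
  (∀ a b c d : X, a ∈ V → b ∈ V → c ∈ V → d ∈ V →
      (succ (a, b) (c, d) ↔ succ (d, c) (b, a)))

/-- A linear ordinal margin matrix: additionally `≻` is connected on pairs of
distinct alternatives, hence a strict linear order there. -/
def IsLinearOMM (V : Finset X) (succ : X × X → X × X → Prop) : Prop :=
  IsOMM V succ ∧
  ∀ a b c d : X, a ∈ V → b ∈ V → c ∈ V → d ∈ V → a ≠ b → c ≠ d → (a, b) ≠ (c, d) →
    (succ (a, b) (c, d) ∨ succ (c, d) (a, b))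

/-- `a` defeats `b` according to Split Cycle in `(V, succ)`: `(a,b) ≻ (b,a)` and there is no
cycle in the majority graph (a duplicate-free list `l` of vertices of `V` whose consecutive
steps, including the wrap-around step — i.e. all the pairs of `l.zip (l.rotate 1)` — are
majority edges) such that `(a,b)` is an edge of the cycle that is weakest in the cycle,
i.e. `(a,b)` is not `≻`-stronger than any edge of the cycle. -/
def SCdefeats (V : Finset X) (succ : X × X → X × X → Prop) (a b : X) : Prop :=
  a ∈ V ∧ b ∈ V ∧ succ (a, b) (b, a) ∧
    ¬ ∃ l : List X, l.Nodup ∧ (∀ x ∈ l, x ∈ V) ∧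
        (∀ e ∈ l.zip (l.rotate 1), succ (e.1, e.2) (e.2, e.1)) ∧
        (a, b) ∈ l.zip (l.rotate 1) ∧
        (∀ e ∈ l.zip (l.rotate 1), ¬ succ (a, b) (e.1, e.2))

/-- `a` is a Split Cycle winner in `(V, succ)`: `a` is not defeated by any alternative. -/
def SCwinner (V : Finset X) (succ : X × X → X × X → Prop) (a : X) : Prop :=
  a ∈ V ∧ ∀ b ∈ V, ¬ SCdefeats V succ b a

/-- Auxiliary definition of Simple Stable Voting winners, by recursion on a fuel parameter
that is always instantiated to the cardinality of the set of alternatives (deleting a member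
of `V` decreases the cardinality by exactly one, so the fuel always matches). -/
def SSVwinAux (succ : X × X → X × X → Prop) : ℕ → Finset X → X → Prop
  | 0, _, _ => False
  | n + 1, V, a =>
      V = {a} ∨
        (1 < V.card ∧ ∃ b ∈ V, a ∈ V.erase b ∧ SSVwinAux succ n (V.erase b) a ∧
          ∀ c d : X, d ∈ V → c ∈ V.erase d → (c, d) ≠ (a, b) →
            SSVwinAux succ n (V.erase d) c → succ (a, b) (c, d))

/-- `a` is a Simple Stable Voting (SSV) winner in `(V, succ)`: either `V = {a}`, or there is
`b` such that `a` is the SSV winner of `V` with `b` deleted and `(a,b)` is the `≻`-maximal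
pair `(c,d)` of distinct alternatives such that `c` is the SSV winner of `V` with `d`
deleted (i.e. `(a,b)` is `≻`-stronger than every other such pair). -/
def SSVwin (V : Finset X) (succ : X × X → X × X → Prop) (a : X) : Prop :=
  SSVwinAux succ V.card V a

/-- Auxiliary definition of Stable Voting winners (fuel-indexed as in `SSVwinAux`). -/
def SVwinAux (succ : X × X → X × X → Prop) : ℕ → Finset X → X → Prop
  | 0, _, _ => False
  | n + 1, V, a =>
      V = {a} ∨
        (1 < V.card ∧ ∃ b ∈ V, a ∈ V.erase b ∧ SCwinner V succ a ∧
          SVwinAux succ n (V.erase b) a ∧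
          ∀ c d : X, d ∈ V → c ∈ V.erase d → (c, d) ≠ (a, b) →
            SCwinner V succ c → SVwinAux succ n (V.erase d) c → succ (a, b) (c, d))

/-- `a` is a Stable Voting (SV) winner in `(V, succ)`: like SSV, but the witnessing pairs
`(c,d)` must additionally have `c` a Split Cycle winner of `(V, succ)`. -/
def SVwin (V : Finset X) (succ : X × X → X × X → Prop) (a : X) : Prop :=
  SVwinAux succ V.card V a

/-- Auxiliary definition of SSV-SE winners (fuel-indexed as in `SSVwinAux`). -/
def SSVSEwinAux (succ : X × X → X × X → Prop) : ℕ → Finset X → X → Prop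
  | 0, _, _ => False
  | n + 1, V, a =>
      V = {a} ∨
        (1 < V.card ∧ ∃ b ∈ V, a ∈ V.erase b ∧ SSVSEwinAux succ n (V.erase b) a ∧
          ∀ c d : X, d ∈ V → c ∈ V.erase d → SSVSEwinAux succ n (V.erase d) c →
            ¬ succ (c, d) (a, b))

/-- `a` is a Simple Stable Voting with Simultaneous Elimination (SSV-SE) winner in
`(V, succ)`: either `V = {a}`, or `a` is the first coordinate of a `≻`-maximal element
`(a,b)` of the set of pairs `(c,d)` of distinct alternatives such that `c` is an SSV-SE
winner of `V` with `d` deleted (maximal: no such pair is `≻`-stronger than `(a,b)`). -/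
def SSVSEwin (V : Finset X) (succ : X × X → X × X → Prop) (a : X) : Prop :=
  SSVSEwinAux succ V.card V a

/-- `succ'` is a linearization of `succ` on `V`: `succ'` is a linear ordinal margin matrix
relation on `V` extending `succ` on `V`. -/
def IsLinearization (V : Finset X) (succ succ' : X × X → X × X → Prop) : Prop :=
  IsLinearOMM V succ' ∧
  ∀ p q : X × X, p.1 ∈ V → p.2 ∈ V → q.1 ∈ V → q.2 ∈ V → succ p q → succ' p q

/-- `a` is an SSV-PUT (parallel-universe tiebreaking) winner in `(V, succ)`:
`a` is the SSV winner of some linearization of `(V, succ)`. -/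
def SSVPUTwin (V : Finset X) (succ : X × X → X × X → Prop) (a : X) : Prop :=
  ∃ succ' : X × X → X × X → Prop, IsLinearization V succ succ' ∧ SSVwin V succ' a

/-- `r` is a strict linear order on (the elements of) `V`. -/
def IsLinOrderOn (V : Finset X) (r : X → X → Prop) : Prop :=
  (∀ a ∈ V, ¬ r a a) ∧
  (∀ a ∈ V, ∀ b ∈ V, ∀ c ∈ V, r a b → r b c → r a c) ∧
  (∀ a ∈ V, ∀ b ∈ V, a ≠ b → (r a b ∨ r b a))

open Classical in
/-- The margin of `a` vs. `b` in the profile `P` with voters `Fin m`: the number of voters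
ranking `a` above `b` minus the number of voters ranking `b` above `a`. -/
noncomputable def margin {m : ℕ} (P : Fin m → X → X → Prop) (a b : X) : ℤ :=
  ((Finset.univ.filter fun i => P i a b).card : ℤ) -
  ((Finset.univ.filter fun i => P i b a).card : ℤ)


/-- `x → y` is an edge inside `V` at least as strong as `e`. -/
def StrongEdge {X : Type} (V : Finset X) (succ : X × X → X × X → Prop) (e : X × X)
    (x y : X) : Prop := x ∈ V ∧ y ∈ V ∧ ¬ succ e (x, y)

theorem IsLinearOMM.mono' {X : Type} [DecidableEq X] {V W : Finset X} {succ : X × X → X × X → Prop}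
    (h : IsLinearOMM V succ) (hW : W ⊆ V) (hne : W.Nonempty) : IsLinearOMM W succ := by
  obtain ⟨⟨_, h1, h2, h3⟩, h4⟩ := h
  refine ⟨⟨hne, ?_, ?_, ?_⟩, ?_⟩
  · intro p q a b c d
    exact h1 p q (hW a) (hW b) (hW c) (hW d)
  · intro p q r a b c d e f
    exact h2 p q r (hW a) (hW b) (hW c) (hW d) (hW e) (hW f)
  · intro p q r s a b c d
    exact h3 p q r s (hW a) (hW b) (hW c) (hW d)
  · intro p q r s a b c d
    exact h4 p q r s (hW a) (hW b) (hW c) (hW d)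

/-- An edge at least as strong as a majority edge is a majority edge. -/
theorem strong_maj {X : Type} [DecidableEq X] {V : Finset X} {succ : X × X → X × X → Prop}
    (h : IsOMM V succ) {b a x y : X} (hb : b ∈ V) (ha : a ∈ V)
    (hba : succ (b, a) (a, b)) (hE : StrongEdge V succ (b, a) x y) : succ (x, y) (y, x) := by
  obtain ⟨_, _, h2, h3⟩ := h
  obtain ⟨hx, hy, hE⟩ := hE
  by_contra hc
  have h5 : ¬ succ (y, x) (a, b) := fun h6 => hE ((h3 b a x y hb ha hx hy).2 h6)
  exact h2 (b, a) (y, x) (a, b) hb ha hy hx ha hb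
    (h2 (b, a) (x, y) (y, x) hb ha hx hy hy hx hE hc) h5 hba

theorem exists_nodup_path {X : Type} {r : X → X → Prop} {a b : X}
    (h : Relation.ReflTransGen r a b) :
    ∃ p : List X, (a :: p).Nodup ∧ (a :: p).IsChain r ∧ (a :: p).getLast (by simp) = b := by
  classical
  induction h using Relation.ReflTransGen.head_induction_on with
  | refl => exact ⟨[], by simp, by simp, by simp⟩
  | @head a c hac _ ih =>
    obtain ⟨p, hn, hc, hl⟩ := ih
    by_cases hm : a ∈ c :: p
    · obtain ⟨s, t, hst⟩ := List.append_of_mem hm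
      refine ⟨t, ?_, ?_, ?_⟩
      · rw [hst] at hn
        exact (List.nodup_append.1 hn).2.1
      · rw [hst] at hc
        exact (List.isChain_append.1 hc).2.1
      · simp only [hst] at hl
        rw [List.getLast_append_of_ne_nil (by simp)] at hl
        exact hl
    · refine ⟨c :: p, List.nodup_cons.2 ⟨hm, hn⟩, ?_, ?_⟩
      · exact List.isChain_cons_cons.2 ⟨hac, hc⟩
      · rw [List.getLast_cons (by simp)]
        exact hl

theorem not_reach_of_defeats {X : Type} [DecidableEq X] {V : Finset X} {succ : X × X → X × X → Prop}
    (h : IsOMM V succ) {b a : X} (hd : SCdefeats V succ b a) :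
    ¬ Relation.ReflTransGen (StrongEdge V succ (b, a)) a b := by
  intro hr
  obtain ⟨hb, ha, hba, hno⟩ := hd
  obtain ⟨p, hn, hc, hl⟩ := exists_nodup_path hr
  have hirr : ¬ succ (b, a) (b, a) := fun h6 => h.2.1 _ _ hb ha hb ha h6 h6
  have key : ∀ e ∈ (a :: p).zip ((a :: p).rotate 1), StrongEdge V succ (b, a) e.1 e.2 := by
    intro e he
    obtain ⟨i, hi, rfl⟩ := List.mem_iff_getElem.1 he
    simp only [List.length_zip, List.length_rotate, min_self] at hi
    rw [List.getElem_zip, List.getElem_rotate]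
    by_cases hlast : i + 1 < (a :: p).length
    · simp only [Nat.mod_eq_of_lt hlast]
      exact List.isChain_iff_getElem.1 hc i hlast
    · have hi' : i + 1 = (a :: p).length := by omega
      have h1 : (a :: p)[i] = b := by
        rw [← hl, List.getLast_eq_getElem]
        congr 1
        omega
      have h2 : (i + 1) % (a :: p).length = 0 := by rw [hi']; simp
      simp only [h2, h1]
      exact ⟨hb, ha, hirr⟩
  apply hno
  refine ⟨a :: p, hn, ?_, fun e he => strong_maj h hb ha hba (key e he), ?_,
    fun e he => (key e he).2.2⟩
  · intro x hx
    obtain ⟨i, hi, rfl⟩ := List.mem_iff_getElem.1 hx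
    have hm : (((a :: p).zip ((a :: p).rotate 1))[i]'(by
      simpa using hi)) ∈ (a :: p).zip ((a :: p).rotate 1) := List.getElem_mem _
    have := (key _ hm).1
    rw [List.getElem_zip] at this
    exact this
  · refine List.mem_iff_getElem.2 ⟨p.length, by simp, ?_⟩
    rw [List.getElem_zip, List.getElem_rotate]
    have h1 : (a :: p)[p.length] = b := by
      rw [← hl, List.getLast_eq_getElem]
      simp
    simp [h1]

theorem reach_of_not_defeats {X : Type} [DecidableEq X] {V : Finset X} {succ : X × X → X × X → Prop}
    {b a : X} (hb : b ∈ V) (ha : a ∈ V) (hba : succ (b, a) (a, b))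
    (hd : ¬ SCdefeats V succ b a) :
    Relation.ReflTransGen (StrongEdge V succ (b, a)) a b := by
  have : ∃ l : List X, l.Nodup ∧ (∀ x ∈ l, x ∈ V) ∧
        (∀ e ∈ l.zip (l.rotate 1), succ (e.1, e.2) (e.2, e.1)) ∧
        (b, a) ∈ l.zip (l.rotate 1) ∧
        (∀ e ∈ l.zip (l.rotate 1), ¬ succ (b, a) (e.1, e.2)) := by
    by_contra hc
    exact hd ⟨hb, ha, hba, hc⟩
  obtain ⟨l, _, hV, _, hm, hs⟩ := this
  obtain ⟨i, hi, he⟩ := List.mem_iff_getElem.1 hm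
  simp only [List.length_zip, List.length_rotate, min_self] at hi
  rw [List.getElem_zip, List.getElem_rotate] at he
  obtain ⟨h1, h2⟩ := Prod.mk.inj he
  have hpos : 0 < l.length := by omega
  have step : ∀ k, Relation.ReflTransGen (StrongEdge V succ (b, a)) a
      (l[(i + 1 + k) % l.length]'(Nat.mod_lt _ hpos)) := by
    intro k
    induction k with
    | zero => simp only [Nat.add_zero, h2]; exact Relation.ReflTransGen.refl
    | succ k ih =>
      refine ih.tail ⟨hV _ (List.getElem_mem _), hV _ (List.getElem_mem _), ?_⟩
      have hj : (i + 1 + k) % l.length < l.length := Nat.mod_lt _ hpos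
      have hm' : ((l.zip (l.rotate 1))[(i + 1 + k) % l.length]'(by simpa using hj)) ∈
        l.zip (l.rotate 1) := List.getElem_mem _
      have := hs _ hm'
      rw [List.getElem_zip, List.getElem_rotate] at this
      simpa [Nat.add_assoc] using this
  have hfin := step (l.length - 1)
  have : (i + 1 + (l.length - 1)) % l.length = i := by
    rw [show i + 1 + (l.length - 1) = i + l.length by omega]
    simp [Nat.mod_eq_of_lt hi]
  simp only [this, h1] at hfin
  exact hfin

theorem SCdefeats.mono' {X : Type} [DecidableEq X] {V W : Finset X} {succ : X × X → X × X → Prop}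
    {b a : X} (hW : W ⊆ V) (hb : b ∈ W) (ha : a ∈ W) (hd : SCdefeats V succ b a) :
    SCdefeats W succ b a := by
  obtain ⟨_, _, h1, h2⟩ := hd
  refine ⟨hb, ha, h1, ?_⟩
  rintro ⟨l, p, q, r⟩
  exact h2 ⟨l, p, fun x hx => hW (q x hx), r⟩

/-- A set closed under a relation contains all that is reachable. -/
theorem reach_closed {X : Type} {r : X → X → Prop} {P : X → Prop} {a b : X}
    (h : Relation.ReflTransGen r a b) (ha : P a) (hP : ∀ x y, P x → r x y → P y) : P b := by
  induction h with
  | refl => exact ha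
  | tail _ hr ih => exact hP _ _ ih hr

theorem exists_max {Y : Type} (r : Y → Y → Prop) (S : Finset Y)
    (ht : ∀ x ∈ S, ∀ y ∈ S, ∀ z ∈ S, r x y → r y z → r x z)
    (hc : ∀ x ∈ S, ∀ y ∈ S, x ≠ y → r x y ∨ r y x) (hne : S.Nonempty) :
    ∃ m ∈ S, ∀ y ∈ S, y ≠ m → r m y := by
  classical
  induction hne using Finset.Nonempty.cons_induction with
  | singleton a => exact ⟨a, by simp, by simp⟩
  | cons a s has _ ih =>
    have sub : ∀ x ∈ s, x ∈ Finset.cons a s has := fun x hx => Finset.mem_cons_of_mem hx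
    have ma : a ∈ Finset.cons a s has := Finset.mem_cons_self _ _
    obtain ⟨m, hm, hmax⟩ := ih
      (fun x hx y hy z hz => ht x (sub x hx) y (sub y hy) z (sub z hz))
      (fun x hx y hy => hc x (sub x hx) y (sub y hy))
    have hne : a ≠ m := fun h => has (h ▸ hm)
    rcases hc a ma m (sub m hm) hne with h1 | h1
    · refine ⟨a, ma, fun y hy hya => ?_⟩
      have hys : y ∈ s := (Finset.mem_cons.1 hy).resolve_left hya
      by_cases hym : y = m
      · rw [hym]; exact h1
      · exact ht a ma m (sub m hm) y hy h1 (hmax y hys hym)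
    · refine ⟨m, sub m hm, fun y hy hym => ?_⟩
      rcases Finset.mem_cons.1 hy with rfl | hys
      · exact h1
      · exact hmax y hys hym

theorem ssv_mem {X : Type} [DecidableEq X] {succ : X × X → X × X → Prop} {n : ℕ}
    {V : Finset X} {a : X} (h : SSVwinAux succ n V a) : a ∈ V := by
  cases n with
  | zero => exact h.elim
  | succ n =>
    rcases h with h | ⟨_, b, _, h, _⟩
    · simp [h]
    · exact Finset.mem_of_mem_erase h

theorem ssv_exists {X : Type} [DecidableEq X] {succ : X × X → X × X → Prop} (n : ℕ) :
    ∀ V : Finset X, IsLinearOMM V succ → V.card = n → ∃ a, SSVwinAux succ n V a := by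
  classical
  induction n with
  | zero =>
    intro V h hc
    exact absurd h.1.1 (by simp [Finset.card_eq_zero.1 hc])
  | succ n ih =>
    intro V h hc
    by_cases h1 : V.card = 1
    · obtain ⟨a, ha⟩ := Finset.card_eq_one.1 h1
      exact ⟨a, Or.inl ha⟩
    have hgt : 1 < V.card := by
      have := h.1.1.card_pos
      omega
    let S := (V ×ˢ V).filter fun p => p.1 ≠ p.2 ∧ SSVwinAux succ n (V.erase p.2) p.1
    have memS : ∀ p, p ∈ S ↔ (p.1 ∈ V ∧ p.2 ∈ V) ∧ p.1 ≠ p.2 ∧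
        SSVwinAux succ n (V.erase p.2) p.1 := by
      intro p
      simp [S]
    have hSne : S.Nonempty := by
      obtain ⟨d, hd⟩ := h.1.1
      have hcard : (V.erase d).card = n := by rw [Finset.card_erase_of_mem hd]; omega
      have hne : (V.erase d).Nonempty := Finset.card_pos.1 (by omega)
      obtain ⟨c, hw⟩ := ih _ (h.mono' (Finset.erase_subset _ _) hne) hcard
      have hm := Finset.mem_erase.1 (ssv_mem hw)
      exact ⟨(c, d), (memS _).2 ⟨⟨hm.2, hd⟩, hm.1, hw⟩⟩
    obtain ⟨⟨_, hasym, hneg, _⟩, hlin⟩ := h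
    obtain ⟨⟨a, b⟩, hm, hmax⟩ := exists_max succ S (by
      intro x hx y hy z hz hxy hyz
      have hx := (memS x).1 hx
      have hy := (memS y).1 hy
      have hz := (memS z).1 hz
      by_contra hxz
      exact hneg x z y hx.1.1 hx.1.2 hz.1.1 hz.1.2 hy.1.1 hy.1.2 hxz
        (hasym _ _ hy.1.1 hy.1.2 hz.1.1 hz.1.2 hyz) hxy) (by
      intro x hx y hy hxy
      have hx := (memS x).1 hx
      have hy := (memS y).1 hy
      exact hlin x.1 x.2 y.1 y.2 hx.1.1 hx.1.2 hy.1.1 hy.1.2 hx.2.1 hy.2.1 hxy) hSne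
    have hm := (memS _).1 hm
    refine ⟨a, Or.inr ⟨hgt, b, hm.1.2, Finset.mem_erase.2 ⟨hm.2.1, hm.1.1⟩, hm.2.2, ?_⟩⟩
    intro c d hd hcd hne hw
    have hcd := Finset.mem_erase.1 hcd
    exact hmax (c, d) ((memS _).2 ⟨⟨hcd.2, hd⟩, hcd.1, hw⟩) hne

/-- The combinatorial core: the configuration arising from a Split Cycle defeat of the
SSV winner is impossible with at most five alternatives. -/
theorem ssv_core {X : Type} [DecidableEq X] {succ : X × X → X × X → Prop} {V : Finset X}
    (h : IsLinearOMM V succ) (hcard : V.card ≤ 5) {a b : X} (hd : SCdefeats V succ b a)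
    (hab : a ≠ b) (hwa : SCwinner (V.erase b) succ a)
    (f : X → X) (hf : ∀ d ∈ V, f d ∈ V ∧ f d ≠ d ∧ ¬ succ (b, a) (d, f d) ∧
      SCwinner (V.erase d) succ (f d)) : False := by
  have hO := h.1
  have hnr := not_reach_of_defeats hO hd
  have hb : b ∈ V := hd.1
  have ha : a ∈ V := hd.2.1
  have hba := hd.2.2.1
  have hasym := hO.2.1
  have hneg := hO.2.2.1
  have hedge : ∀ x ∈ V, StrongEdge V succ (b, a) x (f x) := fun x hx =>
    ⟨hx, (hf x hx).1, (hf x hx).2.2.1⟩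
  have hanti : ∀ x y, StrongEdge V succ (b, a) x y → ¬ StrongEdge V succ (b, a) y x := by
    intro x y h1 h2
    exact hasym _ _ h1.1 h1.2.1 h1.2.1 h1.1 (strong_maj hO hb ha hba h1)
      (strong_maj hO hb ha hba h2)
  -- `f x = a` only for `x = b`
  have hfa : ∀ x ∈ V, x ≠ b → f x ≠ a := by
    intro x hx hxb hxa
    have h1 := (hf x hx).2.2.2
    have h2 := (hf x hx).2.1
    rw [hxa] at h1 h2
    have hbe : b ∈ V.erase x := Finset.mem_erase.2 ⟨hxb.symm, hb⟩
    exact h1.2 b hbe (hd.mono' (Finset.erase_subset _ _) hbe h1.1)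
  obtain ⟨c, hc⟩ : ∃ c, c = f a := ⟨_, rfl⟩
  obtain ⟨d, hdd⟩ : ∃ d, d = f c := ⟨_, rfl⟩
  obtain ⟨e, he⟩ : ∃ e, e = f d := ⟨_, rfl⟩
  have hcV : c ∈ V := hc ▸ (hf a ha).1
  have hdV : d ∈ V := hdd ▸ (hf c hcV).1
  have heV : e ∈ V := he ▸ (hf d hdV).1
  have Eac : StrongEdge V succ (b, a) a c := hc ▸ hedge a ha
  have Ecd : StrongEdge V succ (b, a) c d := hdd ▸ hedge c hcV
  have Ede : StrongEdge V succ (b, a) d e := he ▸ hedge d hdV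
  have Eeg := hedge e heV
  have Rc : Relation.ReflTransGen (StrongEdge V succ (b, a)) a c := .single Eac
  have Rd := Rc.tail Ecd
  have Re := Rd.tail Ede
  have Rg := Re.tail Eeg
  have hca : c ≠ a := hc ▸ (hf a ha).2.1
  have hcb : c ≠ b := fun h => hnr (h ▸ Rc)
  have hdb : d ≠ b := fun h => hnr (h ▸ Rd)
  have heb : e ≠ b := fun h => hnr (h ▸ Re)
  have hgb : f e ≠ b := fun h => hnr (h ▸ Rg)
  have hda : d ≠ a := hdd ▸ hfa c hcV hcb
  have hea : e ≠ a := he ▸ hfa d hdV hdb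
  have hga : f e ≠ a := hfa e heV heb
  have hdc : d ≠ c := by have := (hf c hcV).2.1; rwa [← hdd] at this
  have hed : e ≠ d := by have := (hf d hdV).2.1; rwa [← he] at this
  have hge : f e ≠ e := (hf e heV).2.1
  have hec : e ≠ c := fun h => hanti c d Ecd (h ▸ Ede)
  have hgd : f e ≠ d := fun h => hanti d e Ede (h ▸ Eeg)
  have hVeq : ({a, b, c, d, e} : Finset X) = V := by
    apply Finset.eq_of_subset_of_card_le
    · intro x hx
      simp only [Finset.mem_insert, Finset.mem_singleton] at hx
      rcases hx with rfl | rfl | rfl | rfl | rfl <;> assumption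
    · have : ({a, b, c, d, e} : Finset X).card = 5 := by
        rw [Finset.card_insert_of_notMem, Finset.card_insert_of_notMem,
          Finset.card_insert_of_notMem, Finset.card_insert_of_notMem, Finset.card_singleton]
        all_goals simp only [Finset.mem_insert, Finset.mem_singleton]
        all_goals grind
      omega
  have hall : ∀ x ∈ V, x = a ∨ x = b ∨ x = c ∨ x = d ∨ x = e := by
    intro x hx
    rw [← hVeq] at hx
    simpa using hx
  have hgc : f e = c := by
    rcases hall _ (hf e heV).1 with h1 | h1 | h1 | h1 | h1
    · exact absurd h1 hga
    · exact absurd h1 hgb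
    · exact h1
    · exact absurd h1 hgd
    · exact absurd h1 hge
  rw [hgc] at Eeg
  have maj := fun {x y : X} (hE : StrongEdge V succ (b, a) x y) => strong_maj hO hb ha hba hE
  -- strengthening the threshold
  have strong : ∀ {W : Finset X} {x y u v : X}, W ⊆ V → StrongEdge V succ (b, a) x y →
      StrongEdge W succ (x, y) u v → StrongEdge V succ (b, a) u v := by
    intro W x y u v hW h1 h2
    exact ⟨hW h2.1, hW h2.2.1, hneg (b, a) (x, y) (u, v) hb ha h1.1 h1.2.1 (hW h2.1)
      (hW h2.2.1) h1.2.2 h2.2.2⟩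
  have hirr : ∀ x, ¬ StrongEdge V succ (b, a) x x := fun x hx => hanti x x hx hx
  have nb : ∀ x, Relation.ReflTransGen (StrongEdge V succ (b, a)) a x →
      ¬ StrongEdge V succ (b, a) x b := fun x h1 h2 => hnr (h1.tail h2)
  have nca := hanti a c Eac
  -- a general use of the winner property
  have use : ∀ z ∈ V, ∀ x y, SCwinner (V.erase z) succ y → x ≠ z →
      StrongEdge V succ (b, a) x y →
      Relation.ReflTransGen (StrongEdge (V.erase z) succ (x, y)) y x := by
    intro z _ x y hw hxz hE
    have hx : x ∈ V.erase z := Finset.mem_erase.2 ⟨hxz, hE.1⟩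
    exact reach_of_not_defeats hx hw.1 (maj hE) (hw.2 x hx)
  -- step 1 : `d → a` is at least as strong as `a → c`
  have s1 : StrongEdge (V.erase e) succ (a, c) d a := by
    by_contra hno
    have hw := (hf e heV).2.2.2
    rw [hgc] at hw
    have hr := use e heV a c hw hea.symm Eac
    have := reach_closed (P := fun x => x = c ∨ x = d) hr (Or.inl rfl) (by
      intro x y hx hxy
      have hE := strong (Finset.erase_subset _ _) Eac hxy
      have hye := (Finset.mem_erase.1 hxy.2.1).1
      rcases hall y hE.2.1 with h1 | h1 | h1 | h1 | h1
      · subst h1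
        rcases hx with rfl | rfl
        · exact absurd hE nca
        · exact absurd hxy hno
      · subst h1
        rcases hx with rfl | rfl
        · exact absurd hE (nb _ Rc)
        · exact absurd hE (nb _ Rd)
      · exact Or.inl h1
      · exact Or.inr h1
      · exact absurd h1 hye)
    rcases this with h1 | h1
    · exact hca h1.symm
    · exact hda h1.symm
  have Eda := strong (Finset.erase_subset _ _) Eac s1
  -- step 2 : `a → e` is weaker than `b → a`
  have s2 : ¬ StrongEdge V succ (b, a) a e := by
    intro Eae
    have hw := (hf d hdV).2.2.2
    rw [← he] at hw
    have hr := use d hdV a e hw hda.symm Eae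
    have := reach_closed (P := fun x => x = c ∨ x = e) hr (Or.inr rfl) (by
      intro x y hx hxy
      have hE := strong (Finset.erase_subset _ _) Eae hxy
      have hyd := (Finset.mem_erase.1 hxy.2.1).1
      rcases hall y hE.2.1 with h1 | h1 | h1 | h1 | h1
      · subst h1
        rcases hx with rfl | rfl
        · exact absurd hE nca
        · exact absurd hE (hanti _ _ Eae)
      · subst h1
        rcases hx with rfl | rfl
        · exact absurd hE (nb _ Rc)
        · exact absurd hE (nb _ Re)
      · exact Or.inl h1
      · exact absurd h1 hyd
      · exact Or.inr h1)
    rcases this with h1 | h1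
    · exact hca h1.symm
    · exact hea h1.symm
  -- step 3 : contradiction in `V \ {b}`
  have hr := use b hb d a hwa hdb Eda
  have := reach_closed (P := fun x => x = a) hr rfl (by
    intro x y hx hxy
    subst hx
    have hE := strong (Finset.erase_subset _ _) Eda hxy
    have hyb := (Finset.mem_erase.1 hxy.2.1).1
    rcases hall y hE.2.1 with h1 | h1 | h1 | h1 | h1
    · exact h1
    · exact absurd h1 hyb
    · subst h1
      rcases h.2 x y d x ha hcV hdV ha hca.symm hda
        (fun h1 => hda (Prod.mk.inj h1).1.symm) with h2 | h2
      · exact absurd h2 s1.2.2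
      · exact absurd h2 hxy.2.2
    · subst h1
      exact absurd hE (hanti _ _ Eda)
    · subst h1
      exact absurd hE s2)
  exact hda this

theorem ssv_main {X : Type} [DecidableEq X] {succ : X × X → X × X → Prop} (n : ℕ) :
    ∀ V : Finset X, IsLinearOMM V succ → V.card = n → n ≤ 5 →
      ∀ a, SSVwinAux succ n V a → SCwinner V succ a := by
  induction n with
  | zero => intro V _ _ _ a h; exact h.elim
  | succ n ih =>
    intro V h hc hn a hw
    have haV := ssv_mem hw
    refine ⟨haV, ?_⟩
    intro x hxV hdef
    have hirr : ∀ p q, p ∈ V → q ∈ V → ¬ succ (p, q) (p, q) :=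
      fun p q hp hq h6 => h.1.2.1 _ _ hp hq hp hq h6 h6
    rcases hw with hw | ⟨hgt, b, hb, hab, hwa, hmax⟩
    · rw [hw, Finset.mem_singleton] at hxV
      subst hxV
      exact hirr _ _ haV haV hdef.2.2.1
    have hsub : ∀ d ∈ V, (V.erase d).card = n ∧ IsLinearOMM (V.erase d) succ := by
      intro d hd
      have hcard : (V.erase d).card = n := by rw [Finset.card_erase_of_mem hd]; omega
      exact ⟨hcard, h.mono' (Finset.erase_subset _ _) (Finset.card_pos.1 (by omega))⟩
    have ihe : ∀ d ∈ V, ∀ y, SSVwinAux succ n (V.erase d) y → SCwinner (V.erase d) succ y :=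
      fun d hd y hy => ih _ (hsub d hd).2 (hsub d hd).1 (by omega) y hy
    have hwin := ihe b hb a hwa
    have hxb : x = b := by
      by_contra hne
      have hx : x ∈ V.erase b := Finset.mem_erase.2 ⟨hne, hxV⟩
      exact hwin.2 x hx (hdef.mono' (Finset.erase_subset _ _) hx hab)
    subst hxb
    have hex : ∀ d, ∃ y, d ∈ V → SSVwinAux succ n (V.erase d) y := by
      intro d
      by_cases hd : d ∈ V
      · obtain ⟨y, hy⟩ := ssv_exists n _ (hsub d hd).2 (hsub d hd).1
        exact ⟨y, fun _ => hy⟩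
      · exact ⟨d, fun h => absurd h hd⟩
    choose f hf using hex
    refine ssv_core h (by omega) hdef (Finset.mem_erase.1 hab).1 hwin f ?_
    intro d hd
    have hfm := Finset.mem_erase.1 (ssv_mem (hf d hd))
    refine ⟨hfm.2, hfm.1, ?_, ihe d hd _ (hf d hd)⟩
    intro hs
    have hrev := (h.1.2.2.2 x a d (f d) hb haV hd hfm.2).1 hs
    by_cases heq : (f d, d) = (a, x)
    · rw [heq] at hrev
      exact hirr _ _ haV hb hrev
    · exact h.1.2.1 _ _ haV hb hfm.2 hd
        (hmax (f d) d hd (ssv_mem (hf d hd)) heq (hf d hd)) hrev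

/-- For any linear ordinal margin matrix with at most 5 alternatives, the SSV
winner is a Split Cycle winner. -/
theorem ssv_refines_sc_up_to_five {X : Type} [DecidableEq X] (V : Finset X)
    (succ : X × X → X × X → Prop) (h : IsLinearOMM V succ) (hcard : V.card ≤ 5) :
    ∀ a, SSVwin V succ a → SCwinner V succ a := by
  intro a ha
  exact ssv_main V.card V h rfl hcard a ha
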